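/- There is a universal constant C > 0 such that for every λ ∈ {0,1} and all k, p ∈ ℝ³ with k_⊥ ≠ 0 and p_⊥ ≠ 0, one has ‖ ‖k‖^{1/2}·ε(k,λ) − ‖p‖^{1/2}·ε(p,λ) ‖ ≤ C·‖k‖·‖k−p‖·( 1/(‖k‖^{1/2}·‖k_⊥‖) + 1/(‖p‖^{1/2}·‖p_⊥‖) ). -/

import Mathlib

noncomputable section

/-- `k_⊥ = (k⁽²⁾, −k⁽¹⁾, 0)` for `k ∈ ℝ³`. -/
def kperp (k : EuclideanSpace ℝ (Fin 3)) : EuclideanSpace ℝ (Fin 3) :=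
  (WithLp.equiv 2 (Fin 3 → ℝ)).symm ![k 1, -k 0, 0]

/-- First polarization vector `ε(k,0) = k_⊥/‖k_⊥‖`. -/
def eps0 (k : EuclideanSpace ℝ (Fin 3)) : EuclideanSpace ℝ (Fin 3) :=
  ‖kperp k‖⁻¹ • kperp k

/-- Second polarization vector `ε(k,1) = (k/‖k‖) × ε(k,0)`. -/
def eps1 (k : EuclideanSpace ℝ (Fin 3)) : EuclideanSpace ℝ (Fin 3) :=
  (WithLp.equiv 2 (Fin 3 → ℝ)).symm
    (crossProduct (WithLp.equiv 2 (Fin 3 → ℝ) (‖k‖⁻¹ • k)) (WithLp.equiv 2 (Fin 3 → ℝ) (eps0 k)))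

/-- The polarization vectors `ε(k,λ)`, `λ ∈ {0,1}`. -/
def eps (k : EuclideanSpace ℝ (Fin 3)) (l : Fin 2) : EuclideanSpace ℝ (Fin 3) :=
  if l = 0 then eps0 k else eps1 k

/-- Normalization of vectors is Lipschitz away from the origin. -/
theorem norm_normalize_sub_normalize_le {E : Type*} [NormedAddCommGroup E] [NormedSpace ℝ E]
    {x y : E} (hx : x ≠ 0) (hy : y ≠ 0) :
    ‖‖x‖⁻¹ • x - ‖y‖⁻¹ • y‖ ≤ 2 * ‖x - y‖ / ‖x‖ := by
  have hx' : 0 < ‖x‖ := norm_pos_iff.mpr hx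
  have hy' : 0 < ‖y‖ := norm_pos_iff.mpr hy
  have key : ‖x‖⁻¹ • x - ‖y‖⁻¹ • y = ‖x‖⁻¹ • ((x - y) + ((‖y‖ - ‖x‖) * ‖y‖⁻¹) • y) := by
    have h : ‖x‖⁻¹ * ((‖y‖ - ‖x‖) * ‖y‖⁻¹) = ‖x‖⁻¹ - ‖y‖⁻¹ := by field_simp
    rw [smul_add, smul_smul, h, smul_sub, sub_smul]
    abel
  have hle : ‖((‖y‖ - ‖x‖) * ‖y‖⁻¹) • y‖ ≤ ‖x - y‖ := by
    rw [norm_smul, norm_mul, norm_inv, norm_norm, mul_assoc, inv_mul_cancel₀ hy'.ne', mul_one,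
      norm_sub_rev x y]
    exact abs_norm_sub_norm_le y x
  rw [key, norm_smul, norm_inv, norm_norm, div_eq_inv_mul]
  gcongr
  linarith [norm_add_le (x - y) (((‖y‖ - ‖x‖) * ‖y‖⁻¹) • y)]

theorem kperp_sub (k p : EuclideanSpace ℝ (Fin 3)) : kperp (k - p) = kperp k - kperp p := by
  ext i
  fin_cases i <;> simp [kperp]
  ring

theorem norm_kperp_le (k : EuclideanSpace ℝ (Fin 3)) : ‖kperp k‖ ≤ ‖k‖ := by
  rw [EuclideanSpace.norm_eq, EuclideanSpace.norm_eq]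
  apply Real.sqrt_le_sqrt
  simp [kperp, Fin.sum_univ_three]
  nlinarith [sq_nonneg (k 2)]

/-- The cross product on `EuclideanSpace ℝ (Fin 3)`. -/
def euclideanCross (a b : EuclideanSpace ℝ (Fin 3)) : EuclideanSpace ℝ (Fin 3) :=
  (WithLp.equiv 2 (Fin 3 → ℝ)).symm
    (crossProduct (WithLp.equiv 2 (Fin 3 → ℝ) a) (WithLp.equiv 2 (Fin 3 → ℝ) b))

theorem norm_euclideanCross_le (a b : EuclideanSpace ℝ (Fin 3)) :
    ‖euclideanCross a b‖ ≤ ‖a‖ * ‖b‖ := by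
  rw [EuclideanSpace.norm_eq, EuclideanSpace.norm_eq, EuclideanSpace.norm_eq,
    ← Real.sqrt_mul (by positivity)]
  apply Real.sqrt_le_sqrt
  simp [euclideanCross, cross_apply, Fin.sum_univ_three]
  nlinarith [sq_nonneg (a 0 * b 0 + a 1 * b 1 + a 2 * b 2)]

theorem euclideanCross_sub_euclideanCross (a b c d : EuclideanSpace ℝ (Fin 3)) :
    euclideanCross a b - euclideanCross c d =
      euclideanCross (a - c) b + euclideanCross c (b - d) := by
  ext i
  fin_cases i <;> simp [euclideanCross, cross_apply] <;> ring

theorem norm_inv_norm_smul_le_one {E : Type*} [NormedAddCommGroup E] [NormedSpace ℝ E] (x : E) :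
    ‖‖x‖⁻¹ • x‖ ≤ 1 := by
  rw [norm_smul, norm_inv, norm_norm]
  exact inv_mul_le_one

theorem norm_eps_le_one (k : EuclideanSpace ℝ (Fin 3)) (l : Fin 2) : ‖eps k l‖ ≤ 1 := by
  unfold eps
  split_ifs
  · exact norm_inv_norm_smul_le_one _
  · exact (norm_euclideanCross_le (‖k‖⁻¹ • k) (eps0 k)).trans
      (mul_le_one₀ (norm_inv_norm_smul_le_one _) (norm_nonneg _) (norm_inv_norm_smul_le_one _))

theorem ne_zero_of_kperp_ne_zero {k : EuclideanSpace ℝ (Fin 3)} (hk : kperp k ≠ 0) : k ≠ 0 :=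
  norm_pos_iff.mp ((norm_pos_iff.mpr hk).trans_le (norm_kperp_le k))

theorem norm_eps0_sub_le {k p : EuclideanSpace ℝ (Fin 3)} (hk : kperp k ≠ 0)
    (hp : kperp p ≠ 0) : ‖eps0 k - eps0 p‖ ≤ 2 * ‖k - p‖ / ‖kperp k‖ := by
  refine (norm_normalize_sub_normalize_le hk hp).trans ?_
  rw [← kperp_sub]
  gcongr
  exact norm_kperp_le _

theorem norm_eps_sub_le {k p : EuclideanSpace ℝ (Fin 3)} (hk : kperp k ≠ 0)
    (hp : kperp p ≠ 0) (l : Fin 2) : ‖eps k l - eps p l‖ ≤ 4 * ‖k - p‖ / ‖kperp k‖ := by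
  have h0 := norm_eps0_sub_le hk hp
  have hk' : 0 < ‖kperp k‖ := norm_pos_iff.mpr hk
  have hsum : 4 * ‖k - p‖ / ‖kperp k‖ =
      2 * ‖k - p‖ / ‖kperp k‖ + 2 * ‖k - p‖ / ‖kperp k‖ := by ring
  have hnonneg : 0 ≤ 2 * ‖k - p‖ / ‖kperp k‖ := by positivity
  unfold eps
  split_ifs
  · linarith
  · have hdir : ‖‖k‖⁻¹ • k - ‖p‖⁻¹ • p‖ ≤ 2 * ‖k - p‖ / ‖kperp k‖ := by
      refine (norm_normalize_sub_normalize_le (ne_zero_of_kperp_ne_zero hk)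
        (ne_zero_of_kperp_ne_zero hp)).trans ?_
      gcongr
      exact norm_kperp_le k
    change ‖euclideanCross (‖k‖⁻¹ • k) (eps0 k) - euclideanCross (‖p‖⁻¹ • p) (eps0 p)‖ ≤ _
    rw [euclideanCross_sub_euclideanCross, hsum]
    refine (norm_add_le _ _).trans (add_le_add ?_ ?_)
    · refine (norm_euclideanCross_le _ _).trans ?_
      exact (mul_le_of_le_one_right (norm_nonneg _) (norm_inv_norm_smul_le_one _)).trans hdir
    · refine (norm_euclideanCross_le _ _).trans ?_
      exact (mul_le_of_le_one_left (norm_nonneg _) (norm_inv_norm_smul_le_one _)).trans h0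

theorem abs_sqrt_sub_sqrt_le_div {a b : ℝ} (ha : 0 < a) (hb : 0 ≤ b) :
    |√a - √b| ≤ |a - b| / √a := by
  have hs : 0 < √a := Real.sqrt_pos.mpr ha
  have hfac : a - b = (√a - √b) * (√a + √b) := by
    nlinarith [Real.sq_sqrt ha.le, Real.sq_sqrt hb]
  rw [le_div_iff₀ hs, hfac, abs_mul, abs_of_nonneg (add_nonneg hs.le (Real.sqrt_nonneg b))]
  gcongr
  linarith [Real.sqrt_nonneg b]

/-- The elementary estimate on `‖k‖^{1/2}ε(k,λ) − ‖p‖^{1/2}ε(p,λ)` by the photon derivative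
kernel, with a universal constant. -/
theorem sqrt_smul_polarization_diff_bound :
    ∃ C > 0, ∀ (l : Fin 2) (k p : EuclideanSpace ℝ (Fin 3)),
      kperp k ≠ 0 → kperp p ≠ 0 →
      ‖Real.sqrt ‖k‖ • eps k l - Real.sqrt ‖p‖ • eps p l‖ ≤
        C * ‖k‖ * ‖k - p‖ *
          ((Real.sqrt ‖k‖ * ‖kperp k‖)⁻¹ + (Real.sqrt ‖p‖ * ‖kperp p‖)⁻¹) := by
  refine ⟨5, by norm_num, fun l k p hk hp => ?_⟩
  have hk0 : 0 < ‖k‖ := norm_pos_iff.mpr (ne_zero_of_kperp_ne_zero hk)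
  have hkp : 0 < ‖kperp k‖ := norm_pos_iff.mpr hk
  have hs : 0 < √‖k‖ := Real.sqrt_pos.mpr hk0
  have hsplit : √‖k‖ • eps k l - √‖p‖ • eps p l =
      √‖k‖ • (eps k l - eps p l) + (√‖k‖ - √‖p‖) • eps p l := by
    rw [smul_sub, sub_smul]
    abel
  have hdir : ‖√‖k‖ • (eps k l - eps p l)‖ ≤ 4 * ‖k‖ * ‖k - p‖ * (√‖k‖ * ‖kperp k‖)⁻¹ := by
    rw [norm_smul, Real.norm_of_nonneg hs.le]
    calc √‖k‖ * ‖eps k l - eps p l‖ ≤ √‖k‖ * (4 * ‖k - p‖ / ‖kperp k‖) := by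
          gcongr
          exact norm_eps_sub_le hk hp l
      _ = 4 * (√‖k‖ * √‖k‖) * ‖k - p‖ * (√‖k‖ * ‖kperp k‖)⁻¹ := by field_simp
      _ = _ := by rw [Real.mul_self_sqrt hk0.le]
  have hlen : ‖(√‖k‖ - √‖p‖) • eps p l‖ ≤ ‖k‖ * ‖k - p‖ * (√‖k‖ * ‖kperp k‖)⁻¹ := by
    rw [norm_smul, Real.norm_eq_abs]
    calc |√‖k‖ - √‖p‖| * ‖eps p l‖ ≤ |√‖k‖ - √‖p‖| :=
          mul_le_of_le_one_right (abs_nonneg _) (norm_eps_le_one p l)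
      _ ≤ |‖k‖ - ‖p‖| / √‖k‖ := abs_sqrt_sub_sqrt_le_div hk0 (norm_nonneg p)
      _ ≤ ‖k - p‖ / √‖k‖ := by
          gcongr
          exact abs_norm_sub_norm_le k p
      _ = ‖kperp k‖ * ‖k - p‖ * (√‖k‖ * ‖kperp k‖)⁻¹ := by field_simp
      _ ≤ _ := by
          gcongr
          exact norm_kperp_le k
  have hrest : 0 ≤ 5 * ‖k‖ * ‖k - p‖ * (√‖p‖ * ‖kperp p‖)⁻¹ := by positivity
  rw [hsplit, mul_add]
  linarith [norm_add_le (√‖k‖ • (eps k l - eps p l)) ((√‖k‖ - √‖p‖) • eps p l)]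

end
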